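/- arXiv:1608.03959 — 3 statements merged into one kernel-verified Lean document; each statement's English description precedes it below -/
import Mathlib

section
/- Let 0<q<1 and a,b be real numbers. Then the function y(x) = R(a,b,q,x) satisfies the delay differential equation with proportional delay y'(x) = a·y(x) + b·y(qx) for every real x, together with the initial condition y(0) = 1. That is, R(a,b,q,0) = 1 and for every x ∈ ℝ, the derivative of x \mapsto R(a,b,q,x) at x equals a·R(a,b,q,x) + b·R(a,b,q,qx). -/
open Finset

/-- The Ramanujan function `R(a,b,q,x) = 1 + ∑_{n≥1} (xⁿ/n!) ∏_{j=0}^{n-1} (a + b qʲ)`,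
written as a single `tsum` (the `n = 0` term equals `1`). -/
noncomputable def ramanujanR (a b q x : ℝ) : ℝ :=
  ∑' n : ℕ, x ^ n / (Nat.factorial n : ℝ) * ∏ j ∈ Finset.range n, (a + b * q ^ j)

theorem abs_prod_add_mul_pow_le (a b : ℝ) {q : ℝ} (hq0 : 0 ≤ q) (hq1 : q ≤ 1) (n : ℕ) :
    |∏ j ∈ Finset.range n, (a + b * q ^ j)| ≤ (|a| + |b|) ^ n := by
  rw [Finset.abs_prod]
  calc ∏ j ∈ Finset.range n, |a + b * q ^ j|
      ≤ ∏ _j ∈ Finset.range n, (|a| + |b|) := by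
        refine Finset.prod_le_prod (fun _ _ => abs_nonneg _) fun j _ => ?_
        refine (abs_add_le _ _).trans (add_le_add_right ?_ _)
        rw [abs_mul, abs_of_nonneg (pow_nonneg hq0 j)]
        exact mul_le_of_le_one_right (abs_nonneg b) (pow_le_one₀ hq0 hq1)
    _ = (|a| + |b|) ^ n := by simp

theorem summable_pow_div_factorial_mul {P : ℕ → ℝ} {C : ℝ} (hP : ∀ n, |P n| ≤ C ^ n) (x : ℝ) :
    Summable fun n : ℕ => x ^ n / (Nat.factorial n : ℝ) * P n := by
  refine .of_norm_bounded (Real.summable_pow_div_factorial (|x| * C)) fun n => ?_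
  rw [Real.norm_eq_abs, abs_mul, abs_div, abs_pow, Nat.abs_cast, mul_pow, mul_div_right_comm]
  exact mul_le_mul_of_nonneg_left (hP n) (by positivity)

/-- Termwise differentiation of an exponential generating series with geometrically bounded
coefficients. -/
theorem hasDerivAt_tsum_pow_div_factorial_mul {P : ℕ → ℝ} {C : ℝ} (hP : ∀ n, |P n| ≤ C ^ n)
    (x : ℝ) :
    HasDerivAt (fun t : ℝ => ∑' n : ℕ, t ^ n / (Nat.factorial n : ℝ) * P n)
      (∑' n : ℕ, x ^ n / (Nat.factorial n : ℝ) * P (n + 1)) x := by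
  set M : ℝ := |x| + 1 with hM
  have hM0 : 0 ≤ M := by positivity
  have key (y : ℝ) (n : ℕ) : ((n + 1 : ℕ) : ℝ) * y ^ (n + 1 - 1) / (Nat.factorial (n + 1) : ℝ)
      = y ^ n / (Nat.factorial n : ℝ) := by
    rw [Nat.factorial_succ, Nat.cast_mul, Nat.add_sub_cancel]
    exact mul_div_mul_left _ _ (by positivity)
  have hu : Summable fun n : ℕ => (n : ℝ) * M ^ (n - 1) / (Nat.factorial n : ℝ) * C ^ n := by
    rw [← summable_nat_add_iff 1]
    refine ((Real.summable_pow_div_factorial (M * C)).mul_right C).congr fun n => ?_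
    rw [key, mul_pow, pow_succ]
    ring
  have hg' : ∀ (n : ℕ) (y : ℝ), y ∈ Metric.ball (0 : ℝ) M →
      ‖(n : ℝ) * y ^ (n - 1) / (Nat.factorial n : ℝ) * P n‖
        ≤ (n : ℝ) * M ^ (n - 1) / (Nat.factorial n : ℝ) * C ^ n := by
    intro n y hy
    have hy' : |y| ≤ M := by simpa using (mem_ball_zero_iff.mp hy).le
    rw [Real.norm_eq_abs, abs_mul, abs_div, abs_mul, abs_pow, Nat.abs_cast, Nat.abs_cast]
    have := hP n
    gcongr
  have hx : x ∈ Metric.ball (0 : ℝ) M := by simp [hM]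
  have hderiv := hasDerivAt_tsum_of_isPreconnected hu Metric.isOpen_ball
    (convex_ball (0 : ℝ) M).isPreconnected
    (fun n y _ => ((hasDerivAt_pow n y).div_const (Nat.factorial n : ℝ)).mul_const (P n))
    hg' hx (summable_pow_div_factorial_mul hP x) hx
  convert! hderiv using 1
  rw [(Summable.of_norm_bounded hu fun n => hg' n x hx).tsum_eq_zero_add]
  simp_rw [key]
  simp

/-- `y(x) = R(a,b,q,x)` satisfies the proportional-delay DDE `y'(x) = a y(x) + b y(qx)`
with `y(0) = 1`. -/
theorem stmt_2 (q a b : ℝ) (hq0 : 0 < q) (hq1 : q < 1) :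
    ramanujanR a b q 0 = 1 ∧
    ∀ x : ℝ, HasDerivAt (fun t => ramanujanR a b q t)
      (a * ramanujanR a b q x + b * ramanujanR a b q (q * x)) x := by
  have hP := abs_prod_add_mul_pow_le a b hq0.le hq1.le
  refine ⟨?_, fun x => ?_⟩
  · rw [ramanujanR, tsum_eq_single 0 fun n hn => by simp [hn]]
    simp
  · convert! hasDerivAt_tsum_pow_div_factorial_mul hP x using 1
    have hs := summable_pow_div_factorial_mul hP
    rw [ramanujanR, ramanujanR, ← tsum_mul_left, ← tsum_mul_left,
      ← ((hs x).mul_left a).tsum_add ((hs (q * x)).mul_left b)]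
    refine tsum_congr fun n => ?_
    rw [Finset.prod_range_succ, mul_pow]
    ring
end

section
/- Let 0<q<1, 0<α≤1, and a,b ∈ ℝ. Then for every real x ≥ 0, the function y(x) = R_α(a,b,q,x) satisfies the Volterra integral equation y(x) = 1 + \frac{1}{\Gamma(\alpha)} \int_0^x (x-t)^{\alpha - 1}\left(a\,y(t) + b\,y(q t)\right)\,dt, i.e., R_α(a,b,q,x) = 1 + \frac{1}{\Gamma(\alpha)} \int_0^x (x-t)^{\alpha-1}\left(a\,R_α(a,b,q,t) + b\,R_α(a,b,q,q t)\right)\,dt (this is the equation y = 1 + I^\alpha(a\,y(x) + b\,y(qx)) with I^\alpha the Riemann-Liouville fractional integral of order α). -/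
open Finset

/-- The fractional Ramanujan function
`R_α(a,b,q,x) = 1 + ∑_{n≥1} x^{αn}/Γ(αn+1) ∏_{j=0}^{n-1} (a + b q^{αj})`,
written as a single `tsum` (the `n = 0` term equals `1`, since `x^0 = 1` and `Γ(1) = 1`). -/
noncomputable def ramanujanRalpha (α a b q x : ℝ) : ℝ :=
  ∑' n : ℕ, x ^ (α * (n : ℝ)) / Real.Gamma (α * (n : ℝ) + 1) *
    ∏ j ∈ Finset.range n, (a + b * q ^ (α * (j : ℝ)))

open MeasureTheory

/-- `Γ(s + 1) ≥ ∫_T^∞ e^{-t} t^s dt ≥ T^s e^{-T}`. -/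
theorem rpow_mul_exp_neg_le_Gamma {s T : ℝ} (hs : 0 ≤ s) (hT : 0 < T) :
    T ^ s * Real.exp (-T) ≤ Real.Gamma (s + 1) := by
  have hint := Real.GammaIntegral_convergent (s := s + 1) (by linarith)
  rw [Real.Gamma_eq_integral (by linarith), ← integral_exp_neg_Ioi T, ← integral_const_mul]
  simp only [add_sub_cancel_right] at hint ⊢
  have hsub : Set.Ioi T ⊆ Set.Ioi (0 : ℝ) := Set.Ioi_subset_Ioi hT.le
  calc ∫ t in Set.Ioi T, T ^ s * Real.exp (-t)
      ≤ ∫ t in Set.Ioi T, Real.exp (-t) * t ^ s := by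
        refine setIntegral_mono_on ((integrableOn_exp_neg_Ioi T).const_mul _)
          (hint.mono_set hsub) measurableSet_Ioi fun t ht => ?_
        rw [mul_comm]
        gcongr
        exact le_of_lt ht
    _ ≤ ∫ t in Set.Ioi 0, Real.exp (-t) * t ^ s := by
        refine setIntegral_mono_set hint ?_ hsub.eventuallyLE
        refine (ae_restrict_iff' measurableSet_Ioi).2 (.of_forall fun t ht => ?_)
        have : (0 : ℝ) < t := ht
        simp only [Pi.zero_apply]
        positivity

theorem summable_pow_div_Gamma {α M : ℝ} (hα : 0 < α) (hM : 0 ≤ M) :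
    Summable fun n : ℕ => M ^ n / Real.Gamma (α * n + 1) := by
  set L : ℝ := 2 * M + 1
  have hL : 0 < L := by positivity
  set T : ℝ := L ^ α⁻¹
  have hT : 0 < T := by positivity
  have hTL : T ^ α = L := Real.rpow_inv_rpow hL.le hα.ne'
  have hr : M / L < 1 := (div_lt_one hL).2 (by linarith)
  refine Summable.of_nonneg_of_le (fun n => ?_) (fun n => ?_)
    ((summable_geometric_of_lt_one (by positivity) hr).mul_left (Real.exp T))
  · have := Real.Gamma_pos_of_pos (s := α * n + 1) (by positivity)
    positivity
  · have h := rpow_mul_exp_neg_le_Gamma (s := α * n) (by positivity) hT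
    rw [Real.rpow_mul hT.le, hTL, Real.rpow_natCast] at h
    calc M ^ n / Real.Gamma (α * n + 1) ≤ M ^ n / (L ^ n * Real.exp (-T)) := by gcongr
      _ = Real.exp T * (M / L) ^ n := by
        rw [Real.exp_neg, div_pow]
        field_simp

/-- The Riemann–Liouville integral of a power. -/
theorem integral_sub_rpow_mul_rpow {α s x : ℝ} (hα : 0 < α) (hs : 0 ≤ s) (hx : 0 ≤ x) :
    ∫ t in (0 : ℝ)..x, (x - t) ^ (α - 1) * t ^ s =
      x ^ (s + α) * (Real.Gamma α * Real.Gamma (s + 1) / Real.Gamma (s + α + 1)) := by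
  rcases hx.eq_or_lt with rfl | hx
  · rw [Real.zero_rpow (by positivity)]
    simp
  have h := Complex.betaIntegral_scaled ((s + 1 : ℝ) : ℂ) (α : ℂ) hx
  rw [Complex.betaIntegral_eq_Gamma_mul_div _ _ (by simp; linarith) (by simpa)] at h
  have e : ∫ t in (0 : ℝ)..x, (t : ℂ) ^ (((s + 1 : ℝ) : ℂ) - 1) * ((x : ℂ) - t) ^ ((α : ℂ) - 1) =
      ∫ t in (0 : ℝ)..x, (((x - t) ^ (α - 1) * t ^ s : ℝ) : ℂ) := by
    refine intervalIntegral.integral_congr fun t ht => ?_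
    rw [Set.uIcc_of_le hx.le] at ht
    rw [Complex.ofReal_mul, Complex.ofReal_cpow (sub_nonneg.2 ht.2), Complex.ofReal_cpow ht.1,
      mul_comm]
    push_cast
    rw [add_sub_cancel_right]
  rw [e, intervalIntegral.integral_ofReal, ← Complex.ofReal_add, Complex.Gamma_ofReal,
    Complex.Gamma_ofReal, Complex.Gamma_ofReal, ← Complex.ofReal_one, ← Complex.ofReal_sub,
    ← Complex.ofReal_cpow hx.le] at h
  norm_cast at h
  rw [h, show s + 1 + α = s + α + 1 by ring, add_sub_cancel_right, mul_comm (Real.Gamma α)]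

section Series

variable {α a b q : ℝ}

theorem abs_prod_le (hα : 0 < α) (hq0 : 0 < q) (hq1 : q < 1) (n : ℕ) :
    |∏ j ∈ Finset.range n, (a + b * q ^ (α * (j : ℝ)))| ≤ (|a| + |b|) ^ n := by
  rw [Finset.abs_prod]
  refine (Finset.prod_le_prod (g := fun _ => |a| + |b|) (fun _ _ => abs_nonneg _)
    fun j _ => ?_).trans_eq (by simp)
  have h1 : q ^ (α * (j : ℝ)) ≤ 1 := Real.rpow_le_one hq0.le hq1.le (by positivity)
  have h0 : 0 ≤ q ^ (α * (j : ℝ)) := by positivity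
  calc |a + b * q ^ (α * (j : ℝ))| ≤ |a| + |b * q ^ (α * (j : ℝ))| := abs_add_le _ _
    _ ≤ |a| + |b| := by
      rw [abs_mul, abs_of_nonneg h0]
      gcongr
      exact mul_le_of_le_one_right (abs_nonneg b) h1

theorem hasSum_ramanujanRalpha (hα : 0 < α) (hq0 : 0 < q) (hq1 : q < 1) {x : ℝ} (hx : 0 ≤ x) :
    HasSum (fun n : ℕ => x ^ (α * (n : ℝ)) / Real.Gamma (α * (n : ℝ) + 1) *
      ∏ j ∈ Finset.range n, (a + b * q ^ (α * (j : ℝ)))) (ramanujanRalpha α a b q x) := by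
  refine Summable.hasSum (Summable.of_norm_bounded
    (summable_pow_div_Gamma (M := x ^ α * (|a| + |b|)) hα (by positivity)) fun n => ?_)
  have hΓ := Real.Gamma_pos_of_pos (s := α * n + 1) (by positivity)
  rw [norm_mul, Real.norm_of_nonneg (by positivity), Real.norm_eq_abs, Real.rpow_mul hx,
    Real.rpow_natCast, mul_pow, mul_div_right_comm]
  gcongr
  exact abs_prod_le hα hq0 hq1 n

theorem hasSum_ramanujanRalpha_comb (hα : 0 < α) (hq0 : 0 < q) (hq1 : q < 1) {t : ℝ}
    (ht : 0 ≤ t) :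
    HasSum (fun n : ℕ => t ^ (α * (n : ℝ)) / Real.Gamma (α * (n : ℝ) + 1) *
        ∏ j ∈ Finset.range (n + 1), (a + b * q ^ (α * (j : ℝ))))
      (a * ramanujanRalpha α a b q t + b * ramanujanRalpha α a b q (q * t)) := by
  refine (((hasSum_ramanujanRalpha hα hq0 hq1 ht).mul_left a).add
    ((hasSum_ramanujanRalpha hα hq0 hq1 (mul_nonneg hq0.le ht)).mul_left b)).congr_fun ?_
  intro n
  rw [Finset.prod_range_succ, Real.mul_rpow hq0.le ht]
  ring

theorem hasSum_integral_ramanujanRalpha (hα : 0 < α) (hq0 : 0 < q) (hq1 : q < 1) {x : ℝ}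
    (hx : 0 ≤ x) :
    HasSum (fun n : ℕ => ∫ t in (0 : ℝ)..x, (x - t) ^ (α - 1) *
        (t ^ (α * (n : ℝ)) / Real.Gamma (α * (n : ℝ) + 1) *
          ∏ j ∈ Finset.range (n + 1), (a + b * q ^ (α * (j : ℝ)))))
      (∫ t in (0 : ℝ)..x, (x - t) ^ (α - 1) *
        (a * ramanujanRalpha α a b q t + b * ramanujanRalpha α a b q (q * t))) := by
  have hsum := (summable_pow_div_Gamma (M := x ^ α * (|a| + |b|)) hα (by positivity)).mul_right
    (|a| + |b|)
  refine intervalIntegral.hasSum_integral_of_dominated_convergence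
    (fun n t => (x - t) ^ (α - 1) *
      ((x ^ α * (|a| + |b|)) ^ n / Real.Gamma (α * n + 1) * (|a| + |b|)))
    (fun n => ?_) (fun n => .of_forall fun t ht => ?_)
    (.of_forall fun t _ => hsum.mul_left _) ?_ (.of_forall fun t ht => ?_)
  · exact Measurable.aestronglyMeasurable (by fun_prop)
  · rw [Set.uIoc_of_le hx] at ht
    have ht0 : 0 ≤ t := ht.1.le
    have htx : 0 ≤ x - t := sub_nonneg.2 ht.2
    have hΓ := Real.Gamma_pos_of_pos (s := α * n + 1) (by positivity)
    rw [norm_mul, norm_mul, Real.norm_of_nonneg (by positivity), Real.norm_of_nonneg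
      (by positivity), Real.norm_eq_abs, Real.rpow_mul ht0, Real.rpow_natCast]
    calc _ ≤ (x - t) ^ (α - 1) * ((x ^ α) ^ n / Real.Gamma (α * n + 1) *
          (|a| + |b|) ^ (n + 1)) := by
          gcongr
          · exact ht.2
          · exact abs_prod_le hα hq0 hq1 (n + 1)
      _ = _ := by
        rw [mul_pow]
        ring
  · simp_rw [tsum_mul_left]
    have h := (intervalIntegral.intervalIntegrable_rpow' (a := x) (b := 0) (r := α - 1)
      (by linarith)).comp_sub_left x
    simp only [sub_self, sub_zero] at h
    exact h.mul_const _
  · rw [Set.uIoc_of_le hx] at ht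
    exact (hasSum_ramanujanRalpha_comb hα hq0 hq1 ht.1.le).mul_left _

end Series

/-- `y = R_α(a,b,q,·)` satisfies the Volterra integral equation
`y(x) = 1 + (1/Γ(α)) ∫_0^x (x-t)^{α-1} (a y(t) + b y(qt)) dt`,
i.e. `y = 1 + I^α (a y(x) + b y(qx))` with `I^α` the Riemann–Liouville integral. -/
theorem stmt_12 (q α a b : ℝ) (hq0 : 0 < q) (hq1 : q < 1) (hα0 : 0 < α) (hα1 : α ≤ 1) :
    ∀ x : ℝ, 0 ≤ x →
      ramanujanRalpha α a b q x =
        1 + (1 / Real.Gamma α) *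
          ∫ t in (0:ℝ)..x, (x - t) ^ (α - 1) *
            (a * ramanujanRalpha α a b q t + b * ramanujanRalpha α a b q (q * t)) := by
  intro x hx
  have h := (hasSum_integral_ramanujanRalpha (a := a) (b := b) hα0 hq0 hq1 hx).mul_left
    (1 / Real.Gamma α)
  have hR := (hasSum_nat_add_iff' 1).2
    (hasSum_ramanujanRalpha (a := a) (b := b) hα0 hq0 hq1 hx)
  refine eq_add_of_sub_eq' ?_
  simp only [Finset.range_one, Finset.sum_singleton, Nat.cast_zero, mul_zero, Real.rpow_zero,
    zero_add, Real.Gamma_one, div_one, Finset.range_zero, Finset.prod_empty, mul_one] at hR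
  refine hR.unique (h.congr_fun fun n => ?_)
  have hΓα := (Real.Gamma_pos_of_pos hα0).ne'
  have hΓn := (Real.Gamma_pos_of_pos (s := α * n + 1) (by positivity)).ne'
  have hI := integral_sub_rpow_mul_rpow (s := α * n) hα0 (by positivity) hx
  simp_rw [div_mul_eq_mul_div, mul_div_assoc, ← mul_assoc]
  rw [intervalIntegral.integral_mul_const, hI, Nat.cast_add, Nat.cast_one, mul_add, mul_one]
  field_simp
end

section
/- Let 0<q<1, let A and B be n×n real matrices, and let Y_0 ∈ ℝ^n. Define Y(x) = \left(I + \sum_{n=1}^\infty \frac{x^n}{n!} (A+q^{n-1}B)(A+q^{n-2}B)\cdots(A+B)\right) Y_0. Then Y(0) = Y_0 and for every real x, Y is differentiable at x with Y'(x) = A\,Y(x) + B\,Y(qx); i.e., Y solves the system of delay differential equations Y'(x) = A Y(x) + B Y(qx) with initial condition Y(0) = Y_0. -/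
open Finset

/-- The ordered product `(A + q^{m-1} B)(A + q^{m-2} B) ⋯ (A + q B)(A + B)`
(for `m = 0` it is the identity matrix). -/
noncomputable def ramanujanProd {n : ℕ} (A B : Matrix (Fin n) (Fin n) ℝ) (q : ℝ) (m : ℕ) :
    Matrix (Fin n) (Fin n) ℝ :=
  ((List.range m).map (fun i => A + q ^ (m - 1 - i) • B)).prod

/-- The matrix Ramanujan function applied to `Y₀`:
`Y(x) = (I + ∑_{m≥1} (xᵐ/m!) (A+q^{m-1}B)⋯(A+B)) Y₀`. -/
noncomputable def ramanujanMatVec {n : ℕ} (A B : Matrix (Fin n) (Fin n) ℝ) (q : ℝ)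
    (Y₀ : Fin n → ℝ) (x : ℝ) : Fin n → ℝ :=
  ((1 : Matrix (Fin n) (Fin n) ℝ) +
    ∑' m : ℕ, (x ^ (m + 1) / (Nat.factorial (m + 1) : ℝ)) • ramanujanProd A B q (m + 1)).mulVec Y₀

section PantographSeries

variable {F : Type*} [NormedAddCommGroup F] [NormedSpace ℝ F]

theorem norm_le_of_pantograph_rec {A B : F →L[ℝ] F} {q : ℝ} (hq0 : 0 ≤ q) (hq1 : q ≤ 1)
    {v : ℕ → F} (hv : ∀ m, v (m + 1) = A (v m) + q ^ m • B (v m)) (m : ℕ) :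
    ‖v m‖ ≤ ‖v 0‖ * (‖A‖ + ‖B‖) ^ m := by
  induction m with
  | zero => simp
  | succ m ih =>
    have h1 : ‖q ^ m • B (v m)‖ ≤ ‖B‖ * ‖v m‖ := by
      rw [norm_smul, Real.norm_of_nonneg (pow_nonneg hq0 m)]
      exact (mul_le_of_le_one_left (norm_nonneg _) (pow_le_one₀ hq0 hq1)).trans (B.le_opNorm _)
    calc ‖v (m + 1)‖ ≤ ‖A (v m)‖ + ‖q ^ m • B (v m)‖ := hv m ▸ norm_add_le _ _
      _ ≤ (‖A‖ + ‖B‖) * ‖v m‖ := by linarith [A.le_opNorm (v m)]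
      _ ≤ (‖A‖ + ‖B‖) * (‖v 0‖ * (‖A‖ + ‖B‖) ^ m) := by gcongr
      _ = ‖v 0‖ * (‖A‖ + ‖B‖) ^ (m + 1) := by ring

variable [CompleteSpace F]

theorem summable_pow_div_factorial_smul {v : ℕ → F} {C K : ℝ} (hv : ∀ m, ‖v m‖ ≤ C * K ^ m)
    (x : ℝ) : Summable fun m : ℕ => (x ^ m / (m.factorial : ℝ)) • v m := by
  refine .of_norm_bounded ((Real.summable_pow_div_factorial (|x| * K)).mul_left C) fun m => ?_
  rw [norm_smul, norm_div, norm_pow, Real.norm_eq_abs, RCLike.norm_natCast]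
  calc |x| ^ m / (m.factorial : ℝ) * ‖v m‖ ≤ |x| ^ m / (m.factorial : ℝ) * (C * K ^ m) := by
        gcongr
        exact hv m
    _ = C * ((|x| * K) ^ m / (m.factorial : ℝ)) := by ring

theorem hasDerivAt_tsum_pow_div_factorial_smul {v : ℕ → F} {C K : ℝ}
    (hv : ∀ m, ‖v m‖ ≤ C * K ^ m) (x : ℝ) :
    HasDerivAt (fun t : ℝ => ∑' m : ℕ, (t ^ (m + 1) / ((m + 1).factorial : ℝ)) • v (m + 1))
      (∑' m : ℕ, (x ^ m / (m.factorial : ℝ)) • v (m + 1)) x := by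
  have hx : x ∈ Metric.ball (0 : ℝ) (|x| + 1) := by simp
  have hd (m : ℕ) (y : ℝ) :
      HasDerivAt (fun t : ℝ => (t ^ (m + 1) / ((m + 1).factorial : ℝ)) • v (m + 1))
        ((y ^ m / (m.factorial : ℝ)) • v (m + 1)) y := by
    have h : ((m + 1 : ℕ) : ℝ) * y ^ (m + 1 - 1) / ((m + 1).factorial : ℝ) =
        y ^ m / (m.factorial : ℝ) := by
      rw [Nat.factorial_succ, Nat.cast_mul, Nat.add_sub_cancel,
        mul_div_mul_left _ _ (Nat.cast_ne_zero.2 m.succ_ne_zero)]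
    exact h ▸ ((hasDerivAt_pow (m + 1) y).div_const _).smul_const (v (m + 1))
  have hbound (m : ℕ) (y : ℝ) (hy : y ∈ Metric.ball (0 : ℝ) (|x| + 1)) :
      ‖(y ^ m / (m.factorial : ℝ)) • v (m + 1)‖ ≤
        C * K * (((|x| + 1) * K) ^ m / (m.factorial : ℝ)) := by
    have hy' : |y| ≤ |x| + 1 := by simpa using (Metric.mem_ball.1 hy).le
    rw [norm_smul, norm_div, norm_pow, Real.norm_eq_abs, RCLike.norm_natCast]
    calc |y| ^ m / (m.factorial : ℝ) * ‖v (m + 1)‖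
        ≤ (|x| + 1) ^ m / (m.factorial : ℝ) * (C * K ^ (m + 1)) := by
          gcongr
          exact hv (m + 1)
      _ = C * K * (((|x| + 1) * K) ^ m / (m.factorial : ℝ)) := by rw [mul_pow]; ring
  exact hasDerivAt_tsum_of_isPreconnected
    ((Real.summable_pow_div_factorial _).mul_left _) Metric.isOpen_ball
    (convex_ball _ _).isPreconnected (fun m y _ => hd m y) hbound hx
    ((summable_nat_add_iff (f := fun m : ℕ => (x ^ m / (m.factorial : ℝ)) • v m) 1).2
      (summable_pow_div_factorial_smul hv x)) hx

theorem hasDerivAt_pantograph_series {A B : F →L[ℝ] F} {q : ℝ} (hq0 : 0 ≤ q) (hq1 : q ≤ 1)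
    {v : ℕ → F} (hv : ∀ m, v (m + 1) = A (v m) + q ^ m • B (v m)) (x : ℝ) :
    HasDerivAt
      (fun t : ℝ => v 0 + ∑' m : ℕ, (t ^ (m + 1) / ((m + 1).factorial : ℝ)) • v (m + 1))
      (A (v 0 + ∑' m : ℕ, (x ^ (m + 1) / ((m + 1).factorial : ℝ)) • v (m + 1)) +
        B (v 0 + ∑' m : ℕ, ((q * x) ^ (m + 1) / ((m + 1).factorial : ℝ)) • v (m + 1))) x := by
  have hb := norm_le_of_pantograph_rec hq0 hq1 hv
  have hs := summable_pow_div_factorial_smul hb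
  have h0 (y : ℝ) : v 0 + ∑' m : ℕ, (y ^ (m + 1) / ((m + 1).factorial : ℝ)) • v (m + 1) =
      ∑' m : ℕ, (y ^ m / (m.factorial : ℝ)) • v m := by
    simp [(hs y).tsum_eq_zero_add]
  rw [h0, h0, A.map_tsum (hs x), B.map_tsum (hs (q * x)),
    ← (A.summable (hs x)).tsum_add (B.summable (hs (q * x)))]
  convert (hasDerivAt_tsum_pow_div_factorial_smul hb x).const_add (v 0) using 3 with m
  simp only [map_smul, hv m, smul_add, smul_smul]
  congr 2
  ring

end PantographSeries

theorem ramanujanProd_succ {n : ℕ} (A B : Matrix (Fin n) (Fin n) ℝ) (q : ℝ) (m : ℕ) :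
    ramanujanProd A B q (m + 1) = (A + q ^ m • B) * ramanujanProd A B q m := by
  simp only [ramanujanProd, List.range_succ_eq_map, List.map_cons, List.map_map, List.prod_cons]
  congr 3
  funext i
  simp only [Function.comp_apply]
  congr 3
  omega

theorem ramanujanProd_succ_mulVec {n : ℕ} (A B : Matrix (Fin n) (Fin n) ℝ) (q : ℝ)
    (Y₀ : Fin n → ℝ) (m : ℕ) :
    (ramanujanProd A B q (m + 1)).mulVec Y₀ =
      A.mulVec ((ramanujanProd A B q m).mulVec Y₀) +
        q ^ m • B.mulVec ((ramanujanProd A B q m).mulVec Y₀) := by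
  rw [ramanujanProd_succ, ← Matrix.mulVec_mulVec, Matrix.add_mulVec, Matrix.smul_mulVec]

theorem summable_ramanujanProd {n : ℕ} (A B : Matrix (Fin n) (Fin n) ℝ) {q : ℝ}
    (hq0 : 0 ≤ q) (hq1 : q ≤ 1) (x : ℝ) :
    Summable fun m : ℕ => (x ^ m / (m.factorial : ℝ)) • ramanujanProd A B q m := by
  refine Pi.summable.2 fun i => Pi.summable.2 fun j => ?_
  have h := summable_pow_div_factorial_smul
    (norm_le_of_pantograph_rec (A := A.mulVecLin.toContinuousLinearMap)
      (B := B.mulVecLin.toContinuousLinearMap) hq0 hq1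
      (v := fun m => (ramanujanProd A B q m).mulVec (Pi.single j 1))
      (ramanujanProd_succ_mulVec A B q (Pi.single j 1))) x
  simpa using Pi.summable.1 h i

theorem ramanujanMatVec_eq {n : ℕ} (A B : Matrix (Fin n) (Fin n) ℝ) {q : ℝ}
    (hq0 : 0 ≤ q) (hq1 : q ≤ 1) (Y₀ : Fin n → ℝ) (x : ℝ) :
    ramanujanMatVec A B q Y₀ x = (ramanujanProd A B q 0).mulVec Y₀ +
      ∑' m : ℕ, (x ^ (m + 1) / ((m + 1).factorial : ℝ)) •
        (ramanujanProd A B q (m + 1)).mulVec Y₀ := by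
  have hs := (summable_nat_add_iff 1).2 (summable_ramanujanProd A B hq0 hq1 x)
  have h := hs.hasSum.map (Matrix.mulVec.addMonoidHomLeft Y₀)
    (continuous_id.matrix_mulVec continuous_const)
  rw [ramanujanMatVec, Matrix.add_mulVec]
  congr 1
  exact h.tsum_eq.symm.trans (tsum_congr fun m =>
    Matrix.smul_mulVec (x ^ (m + 1) / ((m + 1).factorial : ℝ)) (ramanujanProd A B q (m + 1)) Y₀)

/-- `Y(x) = (I + ∑_{m≥1} (xᵐ/m!) (A+q^{m-1}B)⋯(A+B)) Y₀` satisfies `Y(0) = Y₀` and the system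
of proportional-delay differential equations `Y'(x) = A Y(x) + B Y(qx)`. -/
theorem stmt_14 (n : ℕ) (q : ℝ) (hq0 : 0 < q) (hq1 : q < 1)
    (A B : Matrix (Fin n) (Fin n) ℝ) (Y₀ : Fin n → ℝ) :
    ramanujanMatVec A B q Y₀ 0 = Y₀ ∧
    ∀ x : ℝ, HasDerivAt (fun t => ramanujanMatVec A B q Y₀ t)
      (A.mulVec (ramanujanMatVec A B q Y₀ x) + B.mulVec (ramanujanMatVec A B q Y₀ (q * x))) x := by
  refine ⟨by simp [ramanujanMatVec], fun x => ?_⟩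
  simp only [ramanujanMatVec_eq A B hq0.le hq1.le]
  exact hasDerivAt_pantograph_series (A := A.mulVecLin.toContinuousLinearMap)
    (B := B.mulVecLin.toContinuousLinearMap) hq0.le hq1.le
    (v := fun m => (ramanujanProd A B q m).mulVec Y₀)
    (ramanujanProd_succ_mulVec A B q Y₀) x
end
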